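/- Assume the decomposition hypotheses for the frame (ξ1, ξ2) along x, including the frame condition that ∂ξ_k/∂u_i has no ξ2-component. Given p ∈ ℝ⁴, let Z: U → ℝ², δ: U → ℝ, s: U → ℝ be the unique smooth maps with x(u) − p = dx(u)(Z(u)) + δ(u) ξ1(u) + s(u) ξ2(u). Let u0 ∈ U with Z(u0) = 0 and suppose the matrix (h2_{ij}(u0)) is invertible. Then the Hessian matrix of the affine distance function s at u0 is degenerate (has zero determinant) if and only if det(Id + δ(u0) S1(u0) + s(u0) S2(u0)) = 0. -/

import Mathlib

open Matrix

/-- The partial derivative of `f` in the `i`-th coordinate direction at `u`. -/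
noncomputable def pder {E : Type*} [NormedAddCommGroup E] [NormedSpace ℝ E]
    (f : (Fin 2 → ℝ) → E) (i : Fin 2) (u : Fin 2 → ℝ) : E :=
  fderiv ℝ f u (Pi.single i 1)

theorem fderiv_apply_eq_pder {E : Type*} [NormedAddCommGroup E] [NormedSpace ℝ E]
    (f : (Fin 2 → ℝ) → E) (u v : Fin 2 → ℝ) :
    fderiv ℝ f u v = v 0 • pder f 0 u + v 1 • pder f 1 u := by
  have hv : v = v 0 • (Pi.single 0 1 : Fin 2 → ℝ) + v 1 • Pi.single 1 1 := by
    ext k; fin_cases k <;> simp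
  conv_lhs => rw [hv]
  simp [pder]

theorem pder_congr {E : Type*} [NormedAddCommGroup E] [NormedSpace ℝ E]
    {f g : (Fin 2 → ℝ) → E} {U : Set (Fin 2 → ℝ)} (hU : IsOpen U) (h : ∀ u ∈ U, f u = g u)
    {u : Fin 2 → ℝ} (hu : u ∈ U) (i : Fin 2) : pder f i u = pder g i u := by
  have hfg : f =ᶠ[nhds u] g := Filter.eventually_of_mem (hU.mem_nhds hu) h
  rw [pder, pder, hfg.fderiv_eq]

theorem pder_add {E : Type*} [NormedAddCommGroup E] [NormedSpace ℝ E]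
    {f g : (Fin 2 → ℝ) → E} {u : Fin 2 → ℝ} (hf : DifferentiableAt ℝ f u)
    (hg : DifferentiableAt ℝ g u) (i : Fin 2) :
    pder (fun v => f v + g v) i u = pder f i u + pder g i u := by
  simp [pder, fderiv_fun_add hf hg]

theorem pder_smul {E : Type*} [NormedAddCommGroup E] [NormedSpace ℝ E]
    {c : (Fin 2 → ℝ) → ℝ} {f : (Fin 2 → ℝ) → E} {u : Fin 2 → ℝ} (hc : DifferentiableAt ℝ c u)
    (hf : DifferentiableAt ℝ f u) (i : Fin 2) :
    pder (fun v => c v • f v) i u = c u • pder f i u + pder c i u • f u := by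
  simp [pder, fderiv_fun_smul hc hf]

theorem pder_sub_const {E : Type*} [NormedAddCommGroup E] [NormedSpace ℝ E]
    (f : (Fin 2 → ℝ) → E) (p : E) (i : Fin 2) (u : Fin 2 → ℝ) :
    pder (fun v => f v - p) i u = pder f i u := by
  simp [pder, fderiv_sub_const]

theorem differentiableAt_of_contDiffOn {E : Type*} [NormedAddCommGroup E] [NormedSpace ℝ E]
    {f : (Fin 2 → ℝ) → E} {U : Set (Fin 2 → ℝ)} (hU : IsOpen U)
    (hf : ContDiffOn ℝ (⊤ : ℕ∞) f U) {u : Fin 2 → ℝ} (hu : u ∈ U) : DifferentiableAt ℝ f u :=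
  (hf.contDiffAt (hU.mem_nhds hu)).differentiableAt (by simp)

theorem differentiableAt_pder {E : Type*} [NormedAddCommGroup E] [NormedSpace ℝ E]
    {f : (Fin 2 → ℝ) → E} {U : Set (Fin 2 → ℝ)} (hU : IsOpen U)
    (hf : ContDiffOn ℝ (⊤ : ℕ∞) f U) {u : Fin 2 → ℝ} (hu : u ∈ U) (i : Fin 2) :
    DifferentiableAt ℝ (pder f i) u := by
  have h : ContDiffAt ℝ 1 (fderiv ℝ f) u :=
    (hf.contDiffAt (hU.mem_nhds hu)).fderiv_right (by norm_cast)
  exact (h.differentiableAt (by simp)).clm_apply (differentiableAt_const _)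

/-- Under the decomposition hypotheses for the transversal frame `(ξ1, ξ2)` along `x`
(including the condition that `∂ξ_k/∂u_i` has no `ξ2`-component), if `Z(u0) = 0` and the
matrix `(h2_{ij}(u0))` is invertible, then the Hessian matrix of the affine distance
function `s` at `u0` is degenerate (zero determinant) if and only if
`det(Id + δ(u0) S1(u0) + s(u0) S2(u0)) = 0`. -/
theorem stmt9 (U : Set (Fin 2 → ℝ)) (hU : IsOpen U)
    (x ξ1 ξ2 : (Fin 2 → ℝ) → (Fin 4 → ℝ))
    (hx : ContDiffOn ℝ (⊤ : ℕ∞) x U) (hξ1 : ContDiffOn ℝ (⊤ : ℕ∞) ξ1 U)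
    (hξ2 : ContDiffOn ℝ (⊤ : ℕ∞) ξ2 U)
    (hind : ∀ u ∈ U, LinearIndependent ℝ ![pder x 0 u, pder x 1 u, ξ1 u, ξ2 u])
    (Γ : (Fin 2 → ℝ) → Fin 2 → Fin 2 → (Fin 2 → ℝ))
    (h1 h2 : (Fin 2 → ℝ) → Fin 2 → Fin 2 → ℝ)
    (hΓ : ContDiffOn ℝ (⊤ : ℕ∞) Γ U)
    (hh1 : ContDiffOn ℝ (⊤ : ℕ∞) h1 U) (hh2 : ContDiffOn ℝ (⊤ : ℕ∞) h2 U)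
    (hdec2 : ∀ u ∈ U, ∀ i j : Fin 2,
      pder (pder x j) i u =
        fderiv ℝ x u (Γ u i j) + h1 u i j • ξ1 u + h2 u i j • ξ2 u)
    (S1 S2 : (Fin 2 → ℝ) → Fin 2 → Fin 2 → ℝ)
    (τ1 τ2 : (Fin 2 → ℝ) → (Fin 2 → ℝ))
    (hS1 : ContDiffOn ℝ (⊤ : ℕ∞) S1 U) (hS2 : ContDiffOn ℝ (⊤ : ℕ∞) S2 U)
    (hτ1 : ContDiffOn ℝ (⊤ : ℕ∞) τ1 U) (hτ2 : ContDiffOn ℝ (⊤ : ℕ∞) τ2 U)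
    (hdecξ1 : ∀ u ∈ U, ∀ i : Fin 2,
      pder ξ1 i u = -fderiv ℝ x u (Matrix.of (S1 u) *ᵥ Pi.single i 1)
        + (τ1 u ⬝ᵥ Pi.single i 1) • ξ1 u)
    (hdecξ2 : ∀ u ∈ U, ∀ i : Fin 2,
      pder ξ2 i u = -fderiv ℝ x u (Matrix.of (S2 u) *ᵥ Pi.single i 1)
        + (τ2 u ⬝ᵥ Pi.single i 1) • ξ1 u)
    (p : Fin 4 → ℝ)
    (Z : (Fin 2 → ℝ) → (Fin 2 → ℝ)) (δp s : (Fin 2 → ℝ) → ℝ)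
    (hZ : ContDiffOn ℝ (⊤ : ℕ∞) Z U) (hδp : ContDiffOn ℝ (⊤ : ℕ∞) δp U)
    (hs : ContDiffOn ℝ (⊤ : ℕ∞) s U)
    (hdist : ∀ u ∈ U, x u - p = fderiv ℝ x u (Z u) + δp u • ξ1 u + s u • ξ2 u)
    (u0 : Fin 2 → ℝ) (hu0 : u0 ∈ U)
    (hZ0 : Z u0 = 0)
    (hinv : IsUnit (Matrix.of (h2 u0))) :
    (Matrix.of fun i j : Fin 2 => pder (pder s j) i u0).det = 0 ↔
      (1 + δp u0 • Matrix.of (S1 u0) + s u0 • Matrix.of (S2 u0)).det = 0 := by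
  have hZc : ∀ k, ContDiffOn ℝ (⊤ : ℕ∞) (fun u => Z u k) U := fun k => contDiffOn_pi.1 hZ k
  have hdZ : ∀ u ∈ U, ∀ k, DifferentiableAt ℝ (fun u => Z u k) u := fun u hu k =>
    differentiableAt_of_contDiffOn hU (hZc k) hu
  have key : ∀ u ∈ U, ∀ i : Fin 2, pder x i u =
      Z u 0 • pder (pder x 0) i u + pder (fun v => Z v 0) i u • pder x 0 u
      + (Z u 1 • pder (pder x 1) i u + pder (fun v => Z v 1) i u • pder x 1 u)
      + (δp u • pder ξ1 i u + pder δp i u • ξ1 u)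
      + (s u • pder ξ2 i u + pder s i u • ξ2 u) := by
    intro u hu i
    have hX := differentiableAt_pder hU hx hu
    have hd := differentiableAt_of_contDiffOn hU hδp hu
    have hds := differentiableAt_of_contDiffOn hU hs hu
    have hd1 := differentiableAt_of_contDiffOn hU hξ1 hu
    have hd2 := differentiableAt_of_contDiffOn hU hξ2 hu
    have h0 := (hdZ u hu 0).fun_smul (hX 0)
    have h1 := (hdZ u hu 1).fun_smul (hX 1)
    have h2 := hd.fun_smul hd1
    have h3 := hds.fun_smul hd2
    rw [← pder_sub_const x p, pder_congr hU (g := fun v => Z v 0 • pder x 0 v + Z v 1 • pder x 1 v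
        + δp v • ξ1 v + s v • ξ2 v) (fun v hv => by
          rw [hdist v hv, fderiv_apply_eq_pder]) hu i,
      pder_add ((h0.fun_add h1).fun_add h2) h3, pder_add (h0.fun_add h1) h2, pder_add h0 h1,
      pder_smul (hdZ u hu 0) (hX 0), pder_smul (hdZ u hu 1) (hX 1), pder_smul hd hd1,
      pder_smul hds hd2]
  have comps : ∀ u ∈ U, ∀ i : Fin 2,
      (∀ k : Fin 2, pder (fun v => Z v k) i u + Z u 0 * Γ u i 0 k + Z u 1 * Γ u i 1 k
        - δp u * S1 u k i - s u * S2 u k i - (Pi.single i 1 : Fin 2 → ℝ) k = 0) ∧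
      Z u 0 * h2 u i 0 + Z u 1 * h2 u i 1 + pder s i u = 0 := by
    intro u hu i
    have hk := key u hu i
    have hxi : pder x i u = (Pi.single i 1 : Fin 2 → ℝ) 0 • pder x 0 u
        + (Pi.single i 1 : Fin 2 → ℝ) 1 • pder x 1 u := fderiv_apply_eq_pder x u _
    rw [hdec2 u hu, hdec2 u hu, hdecξ1 u hu, hdecξ2 u hu, hxi] at hk
    simp only [fderiv_apply_eq_pder, Matrix.mulVec_single_one, Matrix.col_apply,
      Matrix.of_apply, dotProduct_single_one] at hk
    have hl := Fintype.linearIndependent_iff.1 (hind u hu)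
      ![pder (fun v => Z v 0) i u + Z u 0 * Γ u i 0 0 + Z u 1 * Γ u i 1 0
        - δp u * S1 u 0 i - s u * S2 u 0 i - (Pi.single i 1 : Fin 2 → ℝ) 0,
        pder (fun v => Z v 1) i u + Z u 0 * Γ u i 0 1 + Z u 1 * Γ u i 1 1
        - δp u * S1 u 1 i - s u * S2 u 1 i - (Pi.single i 1 : Fin 2 → ℝ) 1,
        Z u 0 * h1 u i 0 + Z u 1 * h1 u i 1 + pder δp i u + δp u * τ1 u i + s u * τ2 u i,
        Z u 0 * h2 u i 0 + Z u 1 * h2 u i 1 + pder s i u] (by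
          simp only [Fin.sum_univ_four, Matrix.cons_val]
          rw [← sub_eq_zero] at hk
          rw [← neg_eq_zero, ← hk]
          module)
    refine ⟨fun k => ?_, by simpa using hl 3⟩
    fin_cases k
    · simpa using hl 0
    · simpa using hl 1
  have hess : ∀ i j : Fin 2, pder (pder s j) i u0
      = -(h2 u0 j 0 * pder (fun v => Z v 0) i u0 + h2 u0 j 1 * pder (fun v => Z v 1) i u0) := by
    intro i j
    have hdh2 : ∀ k, DifferentiableAt ℝ (fun v => -h2 v j k) u0 := fun k =>
      (differentiableAt_of_contDiffOn hU (contDiffOn_pi.1 (contDiffOn_pi.1 hh2 j) k) hu0).neg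
    rw [pder_congr hU (g := fun v => Z v 0 • (-h2 v j 0) + Z v 1 • (-h2 v j 1)) (fun v hv => by
        have := (comps v hv j).2
        simp only [smul_eq_mul]
        linarith) hu0 i,
      pder_add ((hdZ u0 hu0 0).fun_smul (hdh2 0)) ((hdZ u0 hu0 1).fun_smul (hdh2 1)),
      pder_smul (hdZ u0 hu0 0) (hdh2 0), pder_smul (hdZ u0 hu0 1) (hdh2 1)]
    simp only [hZ0, Pi.zero_apply, smul_eq_mul]
    ring
  have hdZ0 : ∀ i k : Fin 2, pder (fun v => Z v k) i u0
      = (1 + δp u0 • Matrix.of (S1 u0) + s u0 • Matrix.of (S2 u0)) k i := by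
    intro i k
    have := (comps u0 hu0 i).1 k
    simp only [hZ0, Pi.zero_apply, Pi.single_apply] at this
    simp only [Matrix.add_apply, Matrix.smul_apply, Matrix.of_apply, smul_eq_mul,
      Matrix.one_apply]
    linarith
  have hmat : (Matrix.of fun i j : Fin 2 => pder (pder s j) i u0)
      = (-(Matrix.of (h2 u0) *
        (1 + δp u0 • Matrix.of (S1 u0) + s u0 • Matrix.of (S2 u0))))ᵀ := by
    ext i j
    rw [Matrix.of_apply, hess, hdZ0, hdZ0, Matrix.transpose_apply, Matrix.neg_apply,
      Matrix.mul_apply, Fin.sum_univ_two]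
    rfl
  have hdet : (Matrix.of (h2 u0)).det ≠ 0 := ((Matrix.isUnit_iff_isUnit_det _).1 hinv).ne_zero
  rw [hmat, Matrix.det_transpose, Matrix.det_neg, Matrix.det_mul]
  simp [hdet]
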